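/- (Second-moment increment.) For every ε > 0 and every n ∈ ℕ, the one-step increase of the second moment of the estimation value equals Σ_{l ∈ ℕ} Q_l(n+1)·A_ε(l)² − Σ_{l ∈ ℕ} Q_l(n)·A_ε(l)² = (1 + ε²)(2n + 1). -/

import Mathlib

/-- The optimal estimation function `A_ε(l) = ((1+2ε²)^l − 1)(1+ε²)/(2ε²)`. -/
noncomputable def A (ε : ℝ) (l : ℕ) : ℝ :=
  ((1 + 2 * ε ^ 2) ^ l - 1) / (2 * ε ^ 2) * (1 + ε ^ 2)

/-- `D_ε(l) = A_ε(l+1) − A_ε(l)`. -/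
noncomputable def D (ε : ℝ) (l : ℕ) : ℝ := A ε (l + 1) - A ε l

/-- `Q ε n l` is the probability `Q_l(n)` that the counter's symbol equals `l`
after `n` packet arrivals, for the process that starts at symbol `0` and on
each arrival increments the current symbol `l` to `l+1` with probability
`1/D_ε(l)`. -/
noncomputable def Q (ε : ℝ) : ℕ → ℕ → ℝ
  | 0, 0 => 1
  | 0, _ + 1 => 0
  | n + 1, 0 => Q ε n 0 * (1 - 1 / D ε 0)
  | n + 1, l + 1 => Q ε n (l + 1) * (1 - 1 / D ε (l + 1)) + Q ε n l / D ε l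

theorem Q_eq_zero_of_lt (ε : ℝ) {n l : ℕ} (h : n < l) : Q ε n l = 0 := by
  induction n generalizing l with
  | zero =>
    obtain ⟨k, rfl⟩ := Nat.exists_eq_succ_of_ne_zero h.ne'
    simp [Q]
  | succ n ih =>
    obtain ⟨k, rfl⟩ := Nat.exists_eq_succ_of_ne_zero (Nat.ne_of_gt (Nat.zero_lt_of_lt h))
    simp [Q, ih (show n < k + 1 by omega), ih (show n < k by omega)]

theorem tsum_Q_mul (ε : ℝ) (n : ℕ) (f : ℕ → ℝ) :
    ∑' l, Q ε n l * f l = ∑ l ∈ Finset.range (n + 1), Q ε n l * f l := by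
  refine tsum_eq_sum fun l hl => ?_
  rw [Q_eq_zero_of_lt ε (by simpa [Nat.lt_succ_iff] using hl), zero_mul]

/-- The one-step evolution of the expectation of `f` under the counter process. -/
theorem sum_Q_succ_mul (ε : ℝ) (n : ℕ) (f : ℕ → ℝ) :
    ∑ l ∈ Finset.range (n + 2), Q ε (n + 1) l * f l =
      ∑ l ∈ Finset.range (n + 1), Q ε n l * f l +
        ∑ l ∈ Finset.range (n + 1), Q ε n l * ((f (l + 1) - f l) / D ε l) := by
  have stay : ∑ l ∈ Finset.range (n + 1), Q ε n (l + 1) * (1 - 1 / D ε (l + 1)) * f (l + 1) +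
      Q ε n 0 * (1 - 1 / D ε 0) * f 0 =
      ∑ l ∈ Finset.range (n + 1), Q ε n l * (1 - 1 / D ε l) * f l := by
    rw [← Finset.sum_range_succ' (fun l => Q ε n l * (1 - 1 / D ε l) * f l),
      Finset.sum_range_succ, Q_eq_zero_of_lt ε (Nat.lt_succ_self n)]
    simp
  rw [Finset.sum_range_succ']
  simp only [Q, add_mul, Finset.sum_add_distrib]
  rw [add_right_comm, stay, ← Finset.sum_add_distrib, ← Finset.sum_add_distrib]
  refine Finset.sum_congr rfl fun l _ => ?_
  ring

theorem D_eq_mul_pow {ε : ℝ} (hε : 0 < ε) (l : ℕ) :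
    D ε l = (1 + ε ^ 2) * (1 + 2 * ε ^ 2) ^ l := by
  unfold D A
  field_simp
  ring

theorem D_eq_A {ε : ℝ} (hε : 0 < ε) (l : ℕ) : D ε l = 2 * ε ^ 2 * A ε l + (1 + ε ^ 2) := by
  rw [D_eq_mul_pow hε]
  unfold A
  field_simp
  ring

theorem D_pos {ε : ℝ} (hε : 0 < ε) (l : ℕ) : 0 < D ε l := by
  rw [D_eq_mul_pow hε]
  positivity

theorem sum_Q (ε : ℝ) (n : ℕ) : ∑ l ∈ Finset.range (n + 1), Q ε n l = 1 := by
  induction n with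
  | zero => simp [Q]
  | succ n ih => simpa [ih] using sum_Q_succ_mul ε n (fun _ => 1)

theorem sum_Q_mul_A {ε : ℝ} (hε : 0 < ε) (n : ℕ) :
    ∑ l ∈ Finset.range (n + 1), Q ε n l * A ε l = n := by
  induction n with
  | zero => simp [Q, A]
  | succ n ih =>
    have step (l : ℕ) : (A ε (l + 1) - A ε l) / D ε l = 1 := div_self (D_pos hε l).ne'
    rw [sum_Q_succ_mul, ih]
    simp [step, sum_Q]

/-- Second-moment increment: for every `ε > 0` and `n`,
`Σ_l Q_l(n+1)·A_ε(l)² − Σ_l Q_l(n)·A_ε(l)² = (1 + ε²)(2n + 1)`. -/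
theorem second_moment_increment (ε : ℝ) (hε : ε > 0) (n : ℕ) :
    (∑' l : ℕ, Q ε (n + 1) l * (A ε l) ^ 2) - (∑' l : ℕ, Q ε n l * (A ε l) ^ 2)
      = (1 + ε ^ 2) * (2 * n + 1) := by
  have step (l : ℕ) : (A ε (l + 1) ^ 2 - A ε l ^ 2) / D ε l = (1 + ε ^ 2) * (2 * A ε l + 1) := by
    have hA : A ε (l + 1) = A ε l + D ε l := by simp [D]
    rw [div_eq_iff (D_pos hε l).ne', hA]
    linear_combination D ε l * D_eq_A hε l
  rw [tsum_Q_mul ε (n + 1) (fun l => A ε l ^ 2), tsum_Q_mul ε n (fun l => A ε l ^ 2),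
    sum_Q_succ_mul, add_sub_cancel_left]
  simp only [step]
  calc ∑ l ∈ Finset.range (n + 1), Q ε n l * ((1 + ε ^ 2) * (2 * A ε l + 1))
      = (1 + ε ^ 2) * (2 * ∑ l ∈ Finset.range (n + 1), Q ε n l * A ε l +
          ∑ l ∈ Finset.range (n + 1), Q ε n l) := by
        rw [Finset.mul_sum, ← Finset.sum_add_distrib, Finset.mul_sum]
        refine Finset.sum_congr rfl fun l _ => ?_
        ring
    _ = (1 + ε ^ 2) * (2 * n + 1) := by rw [sum_Q_mul_A hε, sum_Q]
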